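/- (Weyl bound, special case) For every integer d ≥ 2 and every real ε > 0 there exists a constant C > 0 such that for every prime p, every polynomial F ∈ ℤ[X] of degree d whose leading coefficient is not divisible by p, and every integer h with 1 ≤ h ≤ p: |Σ_{u=1}^{h} e_p(F(u))| ≤ C · h^{1+ε} · (1/h + 1/p + p/h^d)^{1/2^{d−1}}. -/

import Mathlib

/-- `e_m(z) = exp(2 π i z / m)` for an integer `z`. -/
noncomputable def eInt (m : ℕ) (z : ℤ) : ℂ :=
  Complex.exp (2 * Real.pi * Complex.I * (z : ℂ) / m)

open Finset Polynomial

lemma eInt_add (p : ℕ) (x y : ℤ) : eInt p (x + y) = eInt p x * eInt p y := by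
  rw [eInt, eInt, eInt, ← Complex.exp_add]
  congr 1
  push_cast
  ring

lemma eInt_eq_exp_I_mul (p : ℕ) (x : ℤ) :
    eInt p x = Complex.exp (Complex.I * ((2 * Real.pi * x / p : ℝ) : ℂ)) := by
  rw [eInt]
  congr 1
  push_cast
  ring

lemma norm_eInt (p : ℕ) (x : ℤ) : ‖eInt p x‖ = 1 := by
  rw [eInt_eq_exp_I_mul, mul_comm, Complex.norm_exp_ofReal_mul_I]

lemma conj_eInt (p : ℕ) (x : ℤ) : (starRingEnd ℂ) (eInt p x) = eInt p (-x) := by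
  rw [eInt, eInt, ← Complex.exp_conj]
  congr 1
  simp [map_ofNat]

lemma eInt_mul_self (p : ℕ) [NeZero p] (k : ℤ) : eInt p (p * k) = 1 := by
  have hp : (p : ℂ) ≠ 0 := NeZero.ne _
  rw [eInt, Complex.exp_eq_one_iff]
  refine ⟨k, ?_⟩
  push_cast
  field_simp

lemma eInt_val (p : ℕ) [NeZero p] (m : ℤ) : eInt p ((m : ZMod p).val : ℤ) = eInt p m := by
  conv_rhs => rw [← Int.emod_add_mul_ediv m p, eInt_add, eInt_mul_self, mul_one]
  rw [ZMod.val_intCast]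

/-- A majorant for the sums of `e_p(x u + b)` over intervals of at most `h` integers `u`:
the trivial bound for `x = 0`, and a multiple of `1 / ‖x / p‖` otherwise. -/
noncomputable def linearMajorant (p h : ℕ) (x : ZMod p) : ℝ :=
  if x = 0 then h else p / (2 * x.val) + p / (2 * (p - x.val))

lemma norm_eInt_sub_one_ge (p : ℕ) [NeZero p] {r : ℕ} (hr : r < p) :
    4 * min (r : ℝ) (p - r) / p ≤ ‖eInt p r - 1‖ := by
  have hp : (0 : ℝ) < p := by exact_mod_cast Nat.pos_of_neZero p
  have hrp : (r : ℝ) < p := by exact_mod_cast hr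
  have key : ∀ s : ℝ, 0 ≤ s → s ≤ p / 2 → 2 * s / p ≤ Real.sin (Real.pi * s / p) := by
    intro s hs hs2
    have h1 : Real.pi * s / p ≤ Real.pi / 2 := by
      rw [div_le_div_iff₀ hp two_pos]
      nlinarith [Real.pi_pos]
    have := Real.mul_le_sin (x := Real.pi * s / p) (by positivity) h1
    refine le_trans (le_of_eq ?_) this
    field_simp
  rw [eInt_eq_exp_I_mul, Complex.norm_exp_I_mul_ofReal_sub_one, Real.norm_eq_abs]
  refine le_trans ?_ (le_abs_self _)
  have e : 2 * Real.pi * ((r : ℤ) : ℝ) / p / 2 = Real.pi * r / p := by push_cast; ring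
  rw [e]
  rcases le_total (r : ℝ) (p / 2) with h | h
  · have := key r (by positivity) h
    rw [min_eq_left (by linarith)]
    calc 4 * (r : ℝ) / p = 2 * (2 * r / p) := by ring
      _ ≤ _ := by linarith
  · have := key (p - r) (by linarith) (by linarith)
    rw [min_eq_right (by linarith)]
    have e2 : Real.pi * (p - r) / p = Real.pi - Real.pi * r / p := by field_simp
    rw [e2, Real.sin_pi_sub] at this
    calc 4 * ((p : ℝ) - r) / p = 2 * (2 * (p - r) / p) := by ring
      _ ≤ _ := by linarith

lemma norm_sum_eInt_linear_le (p h : ℕ) [NeZero p] (m b A B : ℤ) (hAB : B - A ≤ h) :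
    ‖∑ u ∈ Ioc A B, eInt p (m * u + b)‖ ≤ linearMajorant p h (m : ZMod p) := by
  have hp : (0 : ℝ) < p := by exact_mod_cast Nat.pos_of_neZero p
  rw [linearMajorant]
  split_ifs with hm
  · refine (norm_sum_le _ _).trans ?_
    simp only [norm_eInt, sum_const, Int.card_Ioc, nsmul_eq_mul, mul_one]
    exact_mod_cast (by omega : (B - A).toNat ≤ h)
  · set r := (m : ZMod p).val with hr
    have hr0 : (0 : ℝ) < r := by
      have : r ≠ 0 := by rwa [hr, ne_eq, ZMod.val_eq_zero]
      exact_mod_cast Nat.pos_of_ne_zero this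
    have hrp' : r < p := ZMod.val_lt _
    have hrp : (r : ℝ) < p := by exact_mod_cast hrp'
    have hmaj : 0 ≤ (p : ℝ) / (2 * r) + p / (2 * (p - r)) :=
      add_nonneg (by positivity) (div_nonneg hp.le (by linarith))
    rcases lt_or_ge B A with hlt | hle
    · rw [Ioc_eq_empty (by omega)]
      simpa using hmaj
    have tele : (eInt p m - 1) * ∑ u ∈ Ioc A B, eInt p (m * u + b) =
        eInt p (m * (B + 1) + b) - eInt p (m * (A + 1) + b) := by
      clear hAB
      induction B, hle using Int.leInduction with
      | base => simp
      | succ B hB ih =>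
        have : Ioc A (B + 1) = insert (B + 1) (Ioc A B) := by
          ext x; simp only [mem_Ioc, mem_insert]; omega
        rw [this, sum_insert (by simp), mul_add, ih, sub_mul, ← eInt_add]
        ring_nf
    have h2 : ‖eInt p m - 1‖ * ‖∑ u ∈ Ioc A B, eInt p (m * u + b)‖ ≤ 2 := by
      rw [← norm_mul, tele]
      refine (norm_sub_le _ _).trans ?_
      rw [norm_eInt, norm_eInt]
      norm_num
    have h3 := norm_eInt_sub_one_ge p hrp'
    rw [hr, eInt_val, ← hr] at h3
    set S := ‖∑ u ∈ Ioc A B, eInt p (m * u + b)‖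
    have h4 : 4 * min (r : ℝ) (p - r) / p * S ≤ 2 :=
      (mul_le_mul_of_nonneg_right h3 (norm_nonneg _)).trans h2
    have hmin : 0 < min (r : ℝ) (p - r) := lt_min hr0 (by linarith)
    have h5 : S ≤ p / (2 * min (r : ℝ) (p - r)) := by
      rw [le_div_iff₀ (by positivity)]
      rw [div_mul_eq_mul_div, div_le_iff₀ hp] at h4
      linarith
    refine h5.trans ?_
    rcases min_choice (r : ℝ) (p - r) with h | h <;> rw [h]
    · have : 0 ≤ (p : ℝ) / (2 * (p - r)) := div_nonneg hp.le (by linarith)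
      linarith
    · have : 0 ≤ (p : ℝ) / (2 * r) := by positivity
      linarith

lemma linearMajorant_nonneg (p h : ℕ) [NeZero p] (x : ZMod p) : 0 ≤ linearMajorant p h x := by
  have : (x.val : ℝ) < p := by exact_mod_cast ZMod.val_lt x
  rw [linearMajorant]
  split_ifs
  · positivity
  · exact add_nonneg (by positivity) (div_nonneg (by positivity) (by linarith))

lemma sum_linearMajorant_le (p h : ℕ) [NeZero p] :
    ∑ x : ZMod p with x ≠ 0, linearMajorant p h x ≤ p * (1 + Real.log p) := by
  have hp : 0 < p := Nat.pos_of_neZero p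
  have e : ∑ x : ZMod p with x ≠ 0, linearMajorant p h x =
      ∑ i ∈ range (p - 1), ((p : ℝ) / (2 * (i + 1 : ℕ)) + p / (2 * (p - (i + 1 : ℕ)))) := by
    symm
    refine sum_bij' (fun i _ => ((i + 1 : ℕ) : ZMod p)) (fun x _ => x.val - 1) ?_ ?_ ?_ ?_ ?_
    · intro i hi
      rw [mem_range] at hi
      simp only [mem_filter, mem_univ, true_and, ne_eq]
      rw [ZMod.natCast_eq_zero_iff]
      exact Nat.not_dvd_of_pos_of_lt (by omega) (by omega)
    · intro x hx
      have h1 := ZMod.val_lt x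
      have h2 : x.val ≠ 0 := by simpa using hx
      rw [mem_range]
      omega
    · intro i hi
      rw [mem_range] at hi
      rw [ZMod.val_natCast_of_lt (by omega)]
      rfl
    · intro x hx
      have h2 : x.val ≠ 0 := by simpa using hx
      rw [Nat.sub_add_cancel (by omega), ZMod.natCast_zmod_val]
    · intro i hi
      rw [mem_range] at hi
      have : ((i + 1 : ℕ) : ZMod p) ≠ 0 := by
        rw [ne_eq, ZMod.natCast_eq_zero_iff]
        exact Nat.not_dvd_of_pos_of_lt (by omega) (by omega)
      rw [linearMajorant, if_neg this, ZMod.val_natCast_of_lt (by omega)]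
  have hH : ∑ i ∈ range (p - 1), (1 : ℝ) / (i + 1 : ℕ) ≤ 1 + Real.log p := by
    have h1 := harmonic_le_one_add_log (p - 1)
    have h2 : Real.log ((p - 1 : ℕ) : ℝ) ≤ Real.log p := by
      rcases Nat.eq_zero_or_pos (p - 1) with h0 | h0
      · rw [h0]; simpa using Real.log_natCast_nonneg p
      · exact Real.log_le_log (by exact_mod_cast h0) (by exact_mod_cast Nat.sub_le p 1)
    refine le_trans (le_of_eq ?_) (h1.trans (by linarith))
    simp [harmonic]
  have hR : ∑ i ∈ range (p - 1), (p : ℝ) / (2 * (p - (i + 1 : ℕ))) =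
      ∑ i ∈ range (p - 1), (p : ℝ) / (2 * (i + 1 : ℕ)) := by
    rw [← sum_range_reflect]
    refine sum_congr rfl fun i hi => ?_
    rw [mem_range] at hi
    congr 2
    have : ((p - 1 - 1 - i + 1 : ℕ) : ℝ) + ((i + 1 : ℕ) : ℝ) = p := by
      rw [← Nat.cast_add]
      congr 1
      omega
    linarith
  rw [e, sum_add_distrib, hR, ← two_mul, mul_sum]
  calc ∑ i ∈ range (p - 1), 2 * ((p : ℝ) / (2 * (i + 1 : ℕ)))
      = p * ∑ i ∈ range (p - 1), (1 : ℝ) / (i + 1 : ℕ) := by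
        rw [mul_sum]
        refine sum_congr rfl fun i _ => ?_
        have : ((i + 1 : ℕ) : ℝ) ≠ 0 := by positivity
        field_simp
    _ ≤ _ := by gcongr

lemma norm_sq_sum_eInt_le (p h : ℕ) (f : ℤ → ℤ) (A B : ℤ) (hAB : B - A ≤ h) :
    ‖∑ u ∈ Ioc A B, eInt p (f u)‖ ^ 2 ≤
      ∑ k ∈ Ioo (-h : ℤ) h,
        ‖∑ v ∈ Ioc (max A (A - k)) (min B (B - k)), eInt p (f (v + k) - f v)‖ := by
  have e : ((‖∑ u ∈ Ioc A B, eInt p (f u)‖ ^ 2 : ℝ) : ℂ) =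
      ∑ k ∈ Ioo (-h : ℤ) h,
        ∑ v ∈ Ioc (max A (A - k)) (min B (B - k)), eInt p (f (v + k) - f v) := by
    push_cast
    rw [← Complex.mul_conj', map_sum, sum_mul_sum, sum_sigma', sum_sigma']
    refine sum_bij' (fun x _ => ⟨x.1 - x.2, x.2⟩) (fun x _ => ⟨x.2 + x.1, x.2⟩) ?_ ?_ ?_ ?_ ?_
    · rintro ⟨u, v⟩ hx
      simp only [mem_sigma, mem_Ioc, mem_Ioo] at hx ⊢
      omega
    · rintro ⟨u, v⟩ hx
      simp only [mem_sigma, mem_Ioc, mem_Ioo] at hx ⊢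
      omega
    · rintro ⟨u, v⟩ hx
      simp
    · rintro ⟨u, v⟩ hx
      simp
    · rintro ⟨u, v⟩ hx
      simp only [add_sub_cancel, conj_eInt, sub_eq_add_neg (f u), eInt_add]
  have h2 := congrArg norm e
  rw [Complex.norm_real, Real.norm_of_nonneg (by positivity)] at h2
  rw [h2]
  exact norm_sum_le _ _

lemma coeff_taylor_sub (n : ℕ) (F : ℤ[X]) (hF : F.natDegree ≤ n + 1) (k : ℤ) :
    (taylor k F - F).natDegree ≤ n ∧
      (taylor k F - F).coeff n = (n + 1) * F.coeff (n + 1) * k := by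
  have key : ∀ j, n ≤ j → (taylor k F).coeff j =
      F.coeff j + (j + 1) * F.coeff (j + 1) * k := by
    intro j hj
    have hdeg : (hasseDeriv j F).natDegree < 2 := by
      have := natDegree_hasseDeriv_le F j
      omega
    rw [taylor_coeff, eval_eq_sum_range' hdeg]
    simp [sum_range_succ, hasseDeriv_coeff, add_comm 1 j]
  constructor
  · rw [natDegree_le_iff_coeff_eq_zero]
    intro j hj
    rw [coeff_sub, key j hj.le, coeff_eq_zero_of_natDegree_lt (n := j + 1) (by omega)]
    ring
  · rw [coeff_sub, key n le_rfl]
    ring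

lemma sum_piFinset_succ (n : ℕ) (s : Finset ℤ) (f : (Fin (n + 1) → ℤ) → ℝ) :
    ∑ k ∈ Fintype.piFinset (fun _ : Fin (n + 1) => s), f k =
      ∑ a ∈ s, ∑ k ∈ Fintype.piFinset (fun _ : Fin n => s), f (Fin.cons a k) := by
  rw [← sum_product']
  refine (sum_equiv (Fin.consEquiv fun _ => ℤ) ?_ ?_).symm
  · rintro ⟨a, k⟩
    simp [Fin.consEquiv, Fin.forall_fin_succ]
  · rintro ⟨a, k⟩ _
    rfl

lemma weyl_differencing (p h : ℕ) (g : ℤ → ℝ)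
    (hg : ∀ m b A B : ℤ, B - A ≤ h → ‖∑ u ∈ Ioc A B, eInt p (m * u + b)‖ ≤ g m) (n : ℕ) :
    ∀ F : ℤ[X], F.natDegree ≤ n + 1 → ∀ A B : ℤ, B - A ≤ h →
      (2 * h : ℝ) ^ (n + 1) * ‖∑ u ∈ Ioc A B, eInt p (F.eval u)‖ ^ 2 ^ n ≤
        (2 * h : ℝ) ^ 2 ^ n * ∑ k ∈ Fintype.piFinset (fun _ : Fin n => Ioo (-h : ℤ) h),
          g ((n + 1).factorial * F.coeff (n + 1) * ∏ i, k i) := by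
  induction n with
  | zero =>
    intro F hF A B hAB
    have e : ∀ u : ℤ, F.eval u = F.coeff 1 * u + F.coeff 0 := by
      intro u
      rw [eval_eq_sum_range' (show F.natDegree < 2 by omega)]
      simp [sum_range_succ, add_comm]
    simp only [e]
    simpa using mul_le_mul_of_nonneg_left (hg (F.coeff 1) (F.coeff 0) A B hAB)
      (by positivity : (0 : ℝ) ≤ 2 * h)
  | succ n ih =>
    intro F hF A B hAB
    set S : ℤ → ℝ := fun k => ‖∑ v ∈ Ioc (max A (A - k)) (min B (B - k)),
      eInt p ((taylor k F - F).eval v)‖ with hS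
    have h1 : ‖∑ u ∈ Ioc A B, eInt p (F.eval u)‖ ^ 2 ≤ ∑ k ∈ Ioo (-h : ℤ) h, S k := by
      simpa [hS, taylor_eval] using norm_sq_sum_eInt_le p h (fun u => F.eval u) A B hAB
    have hcard : ((Ioo (-h : ℤ) h).card : ℝ) ≤ 2 * h := by
      rw [Int.card_Ioo]
      exact_mod_cast (by omega : ((h : ℤ) - -h - 1).toNat ≤ 2 * h)
    obtain ⟨N, hN⟩ : ∃ N, 2 ^ n = N + 1 := ⟨2 ^ n - 1, by have := Nat.one_le_two_pow (n := n); omega⟩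
    have h2 : (∑ k ∈ Ioo (-h : ℤ) h, S k) ^ 2 ^ n ≤
        (2 * h : ℝ) ^ N * ∑ k ∈ Ioo (-h : ℤ) h, S k ^ 2 ^ n := by
      rw [hN]
      refine (pow_sum_le_card_mul_sum_pow (fun _ _ => norm_nonneg _) N).trans ?_
      have : 0 ≤ ∑ k ∈ Ioo (-h : ℤ) h, S k ^ (N + 1) :=
        sum_nonneg fun _ _ => pow_nonneg (norm_nonneg _) _
      gcongr
    calc (2 * h : ℝ) ^ (n + 1 + 1) * ‖∑ u ∈ Ioc A B, eInt p (F.eval u)‖ ^ 2 ^ (n + 1)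
        = (2 * h : ℝ) ^ (n + 1 + 1) * (‖∑ u ∈ Ioc A B, eInt p (F.eval u)‖ ^ 2) ^ 2 ^ n := by
          rw [← pow_mul, pow_succ' 2 n]
      _ ≤ (2 * h : ℝ) ^ (n + 1 + 1) * ((2 * h : ℝ) ^ N * ∑ k ∈ Ioo (-h : ℤ) h, S k ^ 2 ^ n) := by
          gcongr
          exact (pow_le_pow_left₀ (by positivity) h1 _).trans h2
      _ = (2 * h : ℝ) ^ 2 ^ n * ∑ k ∈ Ioo (-h : ℤ) h, (2 * h : ℝ) ^ (n + 1) * S k ^ 2 ^ n := by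
          rw [hN, ← mul_sum]
          ring
      _ ≤ (2 * h : ℝ) ^ 2 ^ n * ∑ k ∈ Ioo (-h : ℤ) h, (2 * h : ℝ) ^ 2 ^ n *
            ∑ l ∈ Fintype.piFinset (fun _ : Fin n => Ioo (-h : ℤ) h),
              g ((n + 1).factorial * (taylor k F - F).coeff (n + 1) * ∏ i, l i) := by
          refine mul_le_mul_of_nonneg_left (sum_le_sum fun k _ => ?_) (by positivity)
          exact ih _ (coeff_taylor_sub (n + 1) F hF k).1 _ _ (by omega)
      _ = _ := by
          rw [← mul_sum, ← mul_assoc, ← pow_add, ← two_mul, ← pow_succ', sum_piFinset_succ]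
          congr 1
          refine sum_congr rfl fun k _ => sum_congr rfl fun l _ => ?_
          rw [(coeff_taylor_sub (n + 1) F hF k).2, Fin.prod_univ_succ,
            Nat.factorial_succ (n + 1)]
          simp only [Fin.cons_zero, Fin.cons_succ]
          congr 1
          push_cast
          ring

lemma card_divisors_le_mul_rpow {ε : ℝ} (hε : 0 < ε) :
    ∃ C : ℝ, 0 < C ∧ ∀ n : ℕ, n ≠ 0 → (n.divisors.card : ℝ) ≤ C * (n : ℝ) ^ ε := by
  set K : ℝ := 1 + 1 / (ε * Real.log 2) with hK
  have hl2 : 0 < Real.log 2 := Real.log_pos one_lt_two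
  have hK1 : 1 ≤ K := by rw [hK]; linarith [show 0 < 1 / (ε * Real.log 2) by positivity]
  obtain ⟨N, hN⟩ := exists_nat_ge ((2 : ℝ) ^ (1 / ε))
  have small : ∀ q a : ℕ, 2 ≤ q → ((a + 1 : ℕ) : ℝ) ≤ K * ((q : ℝ) ^ a) ^ ε := by
    intro q a hq
    have h1 : 1 + a * (ε * Real.log 2) ≤ ((q : ℝ) ^ a) ^ ε := by
      calc 1 + a * (ε * Real.log 2) ≤ Real.exp (a * (ε * Real.log 2)) := by
            linarith [Real.add_one_le_exp (a * (ε * Real.log 2))]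
        _ = ((2 : ℝ) ^ a) ^ ε := by
            rw [Real.rpow_def_of_pos (by positivity), Real.log_pow]
            ring_nf
        _ ≤ _ := by
            gcongr
            exact_mod_cast hq
    have h2 : ((a + 1 : ℕ) : ℝ) ≤ K * (1 + a * (ε * Real.log 2)) := by
      have : K * (1 + a * (ε * Real.log 2)) =
          a + 1 + 1 / (ε * Real.log 2) + a * (ε * Real.log 2) := by
        rw [hK]
        field_simp
        ring
      rw [this]
      push_cast
      have : 0 ≤ 1 / (ε * Real.log 2) + a * (ε * Real.log 2) := by positivity
      linarith
    exact h2.trans (by gcongr)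
  have large : ∀ q a : ℕ, N ≤ q → ((a + 1 : ℕ) : ℝ) ≤ ((q : ℝ) ^ a) ^ ε := by
    intro q a hq
    have hq0 : (0 : ℝ) ≤ q := by positivity
    have h1 : (2 : ℝ) ≤ (q : ℝ) ^ ε := by
      calc (2 : ℝ) = ((2 : ℝ) ^ (1 / ε)) ^ ε := by
            rw [← Real.rpow_mul (by norm_num), one_div_mul_cancel hε.ne', Real.rpow_one]
        _ ≤ _ := by
            gcongr
            exact hN.trans (by exact_mod_cast hq)
    calc ((a + 1 : ℕ) : ℝ) ≤ 2 ^ a := by exact_mod_cast Nat.lt_two_pow_self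
      _ ≤ ((q : ℝ) ^ ε) ^ a := by gcongr
      _ = _ := by rw [← Real.rpow_natCast, ← Real.rpow_natCast, ← Real.rpow_mul hq0,
            ← Real.rpow_mul hq0, mul_comm]
  refine ⟨K ^ N, by positivity, fun n hn => ?_⟩
  have hn' : (n : ℝ) ^ ε = ∏ q ∈ n.primeFactors, ((q : ℝ) ^ n.factorization q) ^ ε := by
    rw [Real.finsetProd_rpow _ _ (fun _ _ => by positivity)]
    congr 1
    conv_lhs => rw [← Nat.prod_factorization_pow_eq_self hn]
    rw [Finsupp.prod, Nat.support_factorization]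
    push_cast
    rfl
  calc (n.divisors.card : ℝ) = ∏ q ∈ n.primeFactors, ((n.factorization q + 1 : ℕ) : ℝ) := by
        rw [Nat.card_divisors hn, Nat.cast_prod]
    _ ≤ ∏ q ∈ n.primeFactors,
          ((if q < N then K else 1) * ((q : ℝ) ^ n.factorization q) ^ ε) := by
        refine prod_le_prod (fun _ _ => by positivity) fun q hq => ?_
        split_ifs with h
        · exact small q _ (Nat.prime_of_mem_primeFactors hq).two_le
        · rw [one_mul]
          exact large q _ (not_lt.mp h)
    _ = K ^ #{q ∈ n.primeFactors | q < N} * (n : ℝ) ^ ε := by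
        rw [prod_mul_distrib, ← hn', prod_ite]
        simp
    _ ≤ K ^ N * (n : ℝ) ^ ε := by
        gcongr ?_ * _
        refine pow_le_pow_right₀ hK1 ?_
        calc #{q ∈ n.primeFactors | q < N} ≤ #(range N) :=
                card_le_card fun q hq => by simpa using (mem_filter.mp hq).2
          _ = N := card_range N

lemma card_tuples_prod_eq_zero_le (h n : ℕ) :
    (#{k ∈ Fintype.piFinset (fun _ : Fin n => Ioo (-h : ℤ) h) | ∏ i, k i = 0} : ℝ) ≤
      n * (2 * h : ℝ) ^ (n - 1) := by
  have hsub : {k ∈ Fintype.piFinset (fun _ : Fin n => Ioo (-h : ℤ) h) | ∏ i, k i = 0} ⊆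
      univ.biUnion fun i : Fin n =>
        Fintype.piFinset (Function.update (fun _ : Fin n => Ioo (-h : ℤ) h) i {0}) := by
    intro k hk
    rw [mem_filter, Fintype.mem_piFinset, prod_eq_zero_iff] at hk
    obtain ⟨hk, i, -, hi⟩ := hk
    rw [mem_biUnion]
    refine ⟨i, mem_univ _, Fintype.mem_piFinset.mpr fun j => ?_⟩
    rcases eq_or_ne j i with rfl | hj
    · simp [hi]
    · simpa [hj] using hk j
  have hcard : (Ioo (-h : ℤ) h).card ≤ 2 * h := by
    rw [Int.card_Ioo]
    omega
  have : #{k ∈ Fintype.piFinset (fun _ : Fin n => Ioo (-h : ℤ) h) | ∏ i, k i = 0} ≤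
      n * (2 * h) ^ (n - 1) := by
    refine (card_le_card hsub).trans ?_
    refine (card_biUnion_le_card_mul _ _ ((2 * h) ^ (n - 1)) fun i _ => ?_).trans (by simp)
    rw [Fintype.card_piFinset, ← mul_prod_erase _ _ (mem_univ i)]
    rw [Function.update_self, card_singleton, one_mul]
    refine (prod_le_pow_card _ _ (2 * h) fun j hj => ?_).trans (by simp)
    rw [Function.update_of_ne (ne_of_mem_erase hj)]
    exact hcard
  exact_mod_cast this

lemma card_tuples_prod_eq_le (n : ℕ) (s : Finset (Fin n → ℤ)) {m : ℤ} (hm : m ≠ 0) :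
    #{k ∈ s | ∏ i, k i = m} ≤ (2 * m.natAbs.divisors.card) ^ n := by
  set D : Finset ℤ := m.natAbs.divisors.image (fun a : ℕ => (a : ℤ)) ∪
    m.natAbs.divisors.image (fun a : ℕ => -(a : ℤ)) with hD
  have hDcard : #D ≤ 2 * m.natAbs.divisors.card := by
    rw [two_mul]
    exact (card_union_le _ _).trans (add_le_add card_image_le card_image_le)
  have hsub : {k ∈ s | ∏ i, k i = m} ⊆ Fintype.piFinset fun _ : Fin n => D := by
    intro k hk
    refine Fintype.mem_piFinset.mpr fun i => ?_
    have hdvd : k i ∣ m := (mem_filter.mp hk).2 ▸ dvd_prod_of_mem k (mem_univ i)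
    have hmem : (k i).natAbs ∈ m.natAbs.divisors :=
      Nat.mem_divisors.mpr ⟨Int.natAbs_dvd_natAbs.mpr hdvd, by simpa using hm⟩
    rw [hD, mem_union, mem_image, mem_image]
    rcases Int.natAbs_eq (k i) with h | h
    · exact Or.inl ⟨_, hmem, h.symm⟩
    · exact Or.inr ⟨_, hmem, h.symm⟩
  refine (card_le_card hsub).trans ?_
  simpa using Nat.pow_le_pow_left hDcard n

lemma sum_Icc_zmod_le (p H : ℕ) [NeZero p] (f : ZMod p → ℝ) (hf : ∀ x, 0 ≤ f x) :
    ∑ m ∈ Icc (-H : ℤ) H, f m ≤ (2 * H / p + 2) * ∑ x, f x := by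
  have hp : 0 < p := Nat.pos_of_neZero p
  rw [← sum_fiberwise (Icc (-H : ℤ) H) (fun m : ℤ => (m : ZMod p)), mul_sum]
  refine sum_le_sum fun x _ => ?_
  have e : ∑ m ∈ (Icc (-H : ℤ) H).filter fun m : ℤ => (m : ZMod p) = x, f m =
      #((Icc (-H : ℤ) H).filter fun m : ℤ => (m : ZMod p) = x) * f x := by
    rw [← nsmul_eq_mul, ← sum_const]
    exact sum_congr rfl fun m hm => by rw [(mem_filter.mp hm).2]
  rw [e]
  refine mul_le_mul_of_nonneg_right ?_ (hf x)
  have hset : ((Icc (-H : ℤ) H).filter fun m : ℤ => (m : ZMod p) = x) =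
      {m ∈ Ioc (-H - 1 : ℤ) H | m ≡ x.val [ZMOD p]} := by
    ext m
    simp only [mem_filter, mem_Icc, mem_Ioc, ← ZMod.intCast_eq_intCast_iff, Int.cast_natCast,
      ZMod.natCast_zmod_val]
    refine and_congr_left fun _ => ?_
    omega
  have hc := Int.Ioc_filter_modEq_card (-H - 1 : ℤ) H (r := p) (by exact_mod_cast hp) x.val
  rw [← hset] at hc
  set c := #((Icc (-H : ℤ) H).filter fun m : ℤ => (m : ZMod p) = x)
  have hpQ : (0 : ℚ) < p := by exact_mod_cast hp
  have h1 := Int.floor_le ((((H : ℤ) : ℚ) - ((x.val : ℤ) : ℚ)) / ((p : ℤ) : ℚ))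
  have h2 := Int.lt_floor_add_one ((((-H - 1 : ℤ) : ℚ) - ((x.val : ℤ) : ℚ)) / ((p : ℤ) : ℚ))
  have h3 : (c : ℚ) ≤ 2 * H / p + 2 := by
    have hc' : ((c : ℤ) : ℚ) = _ := congrArg (Int.cast : ℤ → ℚ) hc
    rw [Int.cast_natCast] at hc'
    rw [hc', Int.cast_max]
    refine max_le ?_ (by simp; positivity)
    push_cast at h1 h2 ⊢
    have h4 : ((H : ℚ) - x.val) / p - (-H - 1 - x.val) / p = 2 * H / p + 1 / p := by ring
    have h5 : (1 : ℚ) / p ≤ 1 := by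
      rw [div_le_one hpQ]
      exact_mod_cast hp
    linarith
  have h6 := (Rat.cast_le (K := ℝ)).mpr h3
  push_cast at h6
  exact h6

lemma sum_tuples_linearMajorant_le (p h n : ℕ) [Fact p.Prime] (hh : 1 ≤ h) (hhp : h ≤ p)
    (hn : 1 ≤ n) {c : ℤ} (hc : ¬ (p : ℤ) ∣ c) (T : ℝ)
    (hT : ∀ m : ℤ, m ≠ 0 → |m| ≤ (h : ℤ) ^ n → ((2 * m.natAbs.divisors.card : ℕ) : ℝ) ^ n ≤ T) :
    ∑ k ∈ Fintype.piFinset (fun _ : Fin n => Ioo (-h : ℤ) h),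
        linearMajorant p h ((c * ∏ i, k i : ℤ) : ZMod p) ≤
      n * (2 * h : ℝ) ^ n + T * (2 * (h ^ n + p)) * (1 + Real.log p) := by
  have hp0 : (0 : ℝ) < p := by exact_mod_cast (Fact.out : p.Prime).pos
  have hc0 : (c : ZMod p) ≠ 0 := by rwa [ne_eq, ZMod.intCast_zmod_eq_zero_iff_dvd]
  have hT0 : 0 ≤ T := le_trans (by positivity)
    (hT 1 one_ne_zero (by rw [abs_one]; exact_mod_cast Nat.one_le_pow _ _ hh))
  set P := Fintype.piFinset (fun _ : Fin n => Ioo (-h : ℤ) h) with hP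
  set f : ZMod p → ℝ := fun x => if x = 0 then 0 else linearMajorant p h (c * x) with hf
  have hf0 : ∀ x, 0 ≤ f x := fun x => by
    simp only [hf]
    split_ifs
    · exact le_rfl
    · exact linearMajorant_nonneg _ _ _
  have hfsum : ∑ x, f x ≤ p * (1 + Real.log p) := by
    refine le_trans (le_of_eq ?_) (sum_linearMajorant_le p h)
    rw [sum_filter]
    refine sum_equiv (Equiv.mulLeft₀ (c : ZMod p) hc0) (by simp) fun x _ => ?_
    by_cases hx : x = 0 <;> simp [hf, hx, hc0]
  rw [← sum_filter_add_sum_filter_not P (fun k => ∏ i, k i = 0)]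
  refine add_le_add ?_ ?_
  · have e : ∑ k ∈ P with ∏ i, k i = 0, linearMajorant p h ((c * ∏ i, k i : ℤ) : ZMod p) =
        #{k ∈ P | ∏ i, k i = 0} * h := by
      rw [← nsmul_eq_mul, ← sum_const]
      refine sum_congr rfl fun k hk => ?_
      rw [(mem_filter.mp hk).2]
      simp [linearMajorant]
    rw [e]
    calc (#{k ∈ P | ∏ i, k i = 0} * h : ℝ) ≤ n * (2 * h : ℝ) ^ (n - 1) * (2 * h) := by
          gcongr
          · exact card_tuples_prod_eq_zero_le h n
          · linarith [(Nat.cast_nonneg h : (0 : ℝ) ≤ h)]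
      _ = n * (2 * h : ℝ) ^ n := by
          rw [mul_assoc, ← pow_succ, Nat.sub_add_cancel hn]
  · have habs : ∀ k ∈ P, |∏ i, k i| ≤ (h : ℤ) ^ n := fun k hk => by
      rw [abs_prod]
      refine (prod_le_prod (g := fun _ => (h : ℤ)) (fun _ _ => abs_nonneg _)
        fun i _ => ?_).trans (by simp)
      have := mem_Ioo.mp (Fintype.mem_piFinset.mp hk i)
      exact abs_le.mpr ⟨this.1.le, this.2.le⟩
    have hmaps : ∀ k ∈ P.filter (fun k => ¬ ∏ i, k i = 0),
        ∏ i, k i ∈ Icc (-(h ^ n : ℕ) : ℤ) (h ^ n : ℕ) := fun k hk => by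
      have := habs k (mem_filter.mp hk).1
      rw [mem_Icc]
      push_cast
      exact abs_le.mp this
    rw [← sum_fiberwise_of_maps_to hmaps]
    calc ∑ m ∈ Icc (-(h ^ n : ℕ) : ℤ) (h ^ n : ℕ),
          ∑ k ∈ P.filter (fun k => ¬ ∏ i, k i = 0) with ∏ i, k i = m,
            linearMajorant p h ((c * ∏ i, k i : ℤ) : ZMod p)
        ≤ ∑ m ∈ Icc (-(h ^ n : ℕ) : ℤ) (h ^ n : ℕ), T * f m := by
          refine sum_le_sum fun m hm => ?_
          rcases (P.filter (fun k => ¬ ∏ i, k i = 0) |>.filter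
            fun k => ∏ i, k i = m).eq_empty_or_nonempty with he | ⟨k, hk⟩
          · rw [he, sum_empty]
            exact mul_nonneg hT0 (hf0 _)
          · simp only [mem_filter] at hk
            obtain ⟨⟨hkP, hk0⟩, rfl⟩ := hk
            have hmod : ((∏ i, k i : ℤ) : ZMod p) ≠ 0 := by
              push_cast
              refine prod_ne_zero_iff.mpr fun i _ => ?_
              rw [ne_eq, ZMod.intCast_zmod_eq_zero_iff_dvd]
              intro hdvd
              have hi := mem_Ioo.mp (Fintype.mem_piFinset.mp hkP i)
              refine prod_ne_zero_iff.mp hk0 i (mem_univ i)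
                (Int.eq_zero_of_abs_lt_dvd hdvd (abs_lt.mpr ⟨?_, ?_⟩)) <;> omega
            have hfm : f (∏ i, k i : ℤ) = linearMajorant p h ((c * ∏ i, k i : ℤ) : ZMod p) := by
              simp only [hf, if_neg hmod, Int.cast_mul]
            rw [hfm, sum_congr rfl (g := fun _ =>
              linearMajorant p h ((c * ∏ i, k i : ℤ) : ZMod p)) fun l hl => by
                rw [(mem_filter.mp hl).2], sum_const, nsmul_eq_mul]
            refine mul_le_mul_of_nonneg_right ?_ (linearMajorant_nonneg _ _ _)
            refine le_trans ?_ (hT _ hk0 (habs k hkP))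
            exact_mod_cast card_tuples_prod_eq_le n _ hk0
      _ ≤ T * ((2 * (h ^ n : ℕ) / p + 2) * (p * (1 + Real.log p))) := by
          rw [← mul_sum]
          refine mul_le_mul_of_nonneg_left ?_ hT0
          refine (sum_Icc_zmod_le p (h ^ n) f hf0).trans ?_
          gcongr
      _ = _ := by
          push_cast
          field_simp

lemma pow_norm_weyl_sum_le (n : ℕ) (hn : 1 ≤ n) {δ : ℝ} (hδ : 0 < δ) :
    ∃ M : ℝ, 0 < M ∧ ∀ p : ℕ, p.Prime → n + 1 < p →
      ∀ F : ℤ[X], F.natDegree = n + 1 → ¬ (p : ℤ) ∣ F.leadingCoeff →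
      ∀ h : ℕ, 1 ≤ h → h ≤ p → (p : ℝ) ≤ (h : ℝ) ^ (n + 1) →
        ‖∑ u ∈ Ioc (0 : ℤ) h, eInt p (F.eval u)‖ ^ 2 ^ n ≤
          M * (h : ℝ) ^ 2 ^ n * ((h : ℝ) ^ δ * (h : ℝ) ^ δ) *
            (1 / h + p / (h : ℝ) ^ (n + 1)) := by
  obtain ⟨C, hC, hdiv⟩ := card_divisors_le_mul_rpow (ε := δ / (n * n)) (by positivity)
  refine ⟨2 ^ 2 ^ n * (n * 2 ^ n + 2 * (2 * C) ^ n * (1 + (n + 1) / δ)), by positivity, ?_⟩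
  intro p hp hnp F hF hlead h hh hhp hph
  have := Fact.mk hp
  have hp1 : (1 : ℝ) ≤ p := by exact_mod_cast hp.one_le
  have hh1 : (1 : ℝ) ≤ h := by exact_mod_cast hh
  have hh0 : (0 : ℝ) < h := by linarith
  have hδ1 : 1 ≤ (h : ℝ) ^ δ := Real.one_le_rpow hh1 hδ.le
  have hn0 : (n : ℝ) ≠ 0 := by positivity
  set E : ℝ := (h : ℝ) ^ δ with hE
  have hc : ¬ (p : ℤ) ∣ (n + 1).factorial * F.coeff (n + 1) := by
    rw [← hF, ← leadingCoeff]
    intro hdvd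
    rcases (Nat.prime_iff_prime_int.mp hp).dvd_or_dvd hdvd with h1 | h1
    · rw [Int.natCast_dvd_natCast, hp.dvd_factorial] at h1
      omega
    · exact hlead h1
  have hT : ∀ m : ℤ, m ≠ 0 → |m| ≤ (h : ℤ) ^ n →
      ((2 * m.natAbs.divisors.card : ℕ) : ℝ) ^ n ≤ (2 * C) ^ n * E := by
    intro m hm hmh
    have h1 := hdiv m.natAbs (Int.natAbs_ne_zero.mpr hm)
    have h2 : (m.natAbs : ℝ) ≤ (h : ℝ) ^ n := by
      rw [Nat.cast_natAbs]
      exact_mod_cast hmh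
    have h3 : ((h : ℝ) ^ n) ^ (δ / (n * n)) = (h : ℝ) ^ (δ / n) := by
      rw [← Real.rpow_natCast, ← Real.rpow_mul hh0.le]
      congr 1
      field_simp
    have h4 : ((h : ℝ) ^ (δ / n)) ^ n = E := by
      rw [← Real.rpow_natCast, ← Real.rpow_mul hh0.le, div_mul_cancel₀ _ hn0]
    rw [← h4, ← h3, ← mul_pow]
    refine pow_le_pow_left₀ (by positivity) ?_ n
    push_cast
    rw [mul_assoc]
    gcongr
    exact h1.trans (by gcongr)
  have hlog : 1 + Real.log p ≤ (1 + (n + 1) / δ) * E := by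
    have h1 : Real.log p ≤ (n + 1) * Real.log h := by
      have := Real.log_le_log (by linarith) hph
      rwa [Real.log_pow, Nat.cast_add_one] at this
    have h2 := Real.log_le_rpow_div hh0.le hδ
    calc 1 + Real.log p ≤ E + (n + 1) * (E / δ) := by
          refine add_le_add hδ1 (h1.trans ?_)
          gcongr
      _ = _ := by ring
  have hsum := sum_tuples_linearMajorant_le p h n hh hhp hn hc _ hT
  have hweyl := weyl_differencing p h (fun m => linearMajorant p h (m : ZMod p))
    (norm_sum_eInt_linear_le p h) n F hF.le 0 h (by simp)
  have hbr : (n * (2 * h : ℝ) ^ n + (2 * C) ^ n * E * (2 * (h ^ n + p)) * (1 + Real.log p)) ≤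
      (n * 2 ^ n + 2 * (2 * C) ^ n * (1 + (n + 1) / δ)) * (E * E) * (h ^ n + p) := by
    have hEE : 1 ≤ E * E := one_le_mul_of_one_le_of_one_le hδ1 hδ1
    calc _ ≤ n * 2 ^ n * ((E * E) * (h ^ n + p)) +
          (2 * C) ^ n * E * (2 * (h ^ n + p)) * ((1 + (n + 1) / δ) * E) := by
          rw [mul_pow, ← mul_assoc (n : ℝ)]
          gcongr
          calc (h : ℝ) ^ n ≤ h ^ n + p := by linarith
            _ ≤ _ := le_mul_of_one_le_left (by positivity) hEE
      _ = _ := by ring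
  have htot := hweyl.trans (mul_le_mul_of_nonneg_left (hsum.trans hbr) (by positivity))
  have hle : (h : ℝ) ^ (n + 1) * ‖∑ u ∈ Ioc (0 : ℤ) h, eInt p (F.eval u)‖ ^ 2 ^ n ≤ _ :=
    le_trans (mul_le_mul_of_nonneg_right
      (pow_le_pow_left₀ hh0.le (by linarith : (h : ℝ) ≤ 2 * h) _) (by positivity)) htot
  have hhn : (0 : ℝ) < (h : ℝ) ^ (n + 1) := by positivity
  rw [← le_div_iff₀' hhn] at hle
  refine hle.trans (le_of_eq ?_)
  rw [mul_pow]
  field_simp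
  ring

/-- Weyl bound, special case: For every `d ≥ 2` and `ε > 0` there
is `C > 0` such that for every prime `p`, every `F ∈ ℤ[X]` of degree `d` whose
leading coefficient is not divisible by `p`, and every `1 ≤ h ≤ p`,
`|Σ_{u=1}^h e_p(F(u))| ≤ C h^{1+ε} (1/h + 1/p + p/h^d)^{1/2^{d−1}}`. -/
theorem weyl_bound_special_case
    (d : ℕ) (hd : 2 ≤ d) (ε : ℝ) (hε : 0 < ε) :
    ∃ C : ℝ, 0 < C ∧
      ∀ p : ℕ, p.Prime →
      ∀ F : Polynomial ℤ, F.natDegree = d → ¬ ((p : ℤ) ∣ F.leadingCoeff) →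
      ∀ h : ℕ, 1 ≤ h → h ≤ p →
        ‖∑ u ∈ Finset.Icc 1 h, eInt p (F.eval (u : ℤ))‖ ≤
          C * (h : ℝ) ^ ((1 : ℝ) + ε) *
            (1 / (h : ℝ) + 1 / (p : ℝ) + (p : ℝ) / (h : ℝ) ^ d) ^
              ((1 : ℝ) / 2 ^ (d - 1)) := by
  obtain ⟨n, rfl⟩ : ∃ n, d = n + 1 := ⟨d - 1, by omega⟩
  simp only [Nat.add_sub_cancel]
  obtain ⟨M, hM, hbound⟩ := pow_norm_weyl_sum_le n (by omega) (δ := 2 ^ n * ε / 2) (by positivity)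
  refine ⟨max M (n + 1), by positivity, ?_⟩
  intro p hp F hF hlead h hh hhp
  set C := max M (n + 1)
  have hC1 : 1 ≤ C := le_trans (by linarith [(Nat.cast_nonneg n : (0 : ℝ) ≤ n)]) (le_max_right _ _)
  have hp0 : (0 : ℝ) < p := by exact_mod_cast hp.pos
  have hh1 : (1 : ℝ) ≤ h := by exact_mod_cast hh
  have hh0 : (0 : ℝ) < h := by linarith
  set Q : ℝ := 1 / (h : ℝ) + 1 / (p : ℝ) + (p : ℝ) / (h : ℝ) ^ (n + 1) with hQ
  have hhε : (h : ℝ) ≤ (h : ℝ) ^ (1 + ε) := by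
    conv_lhs => rw [← Real.rpow_one (h : ℝ)]
    exact Real.rpow_le_rpow_of_exponent_le hh1 (by linarith)
  have htriv : ‖∑ u ∈ Finset.Icc 1 h, eInt p (F.eval (u : ℤ))‖ ≤ h :=
    (norm_sum_le _ _).trans (by simp [norm_eInt])
  rcases le_or_gt p (n + 1) with hpn | hpn
  · have hpn' : (h : ℝ) ≤ n + 1 := by exact_mod_cast hhp.trans hpn
    have h1 : 1 / (h : ℝ) ≤ Q ^ ((1 : ℝ) / 2 ^ n) := by
      calc 1 / (h : ℝ) = (1 / (h : ℝ)) ^ (1 : ℝ) := (Real.rpow_one _).symm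
        _ ≤ (1 / (h : ℝ)) ^ ((1 : ℝ) / 2 ^ n) := by
            refine Real.rpow_le_rpow_of_exponent_ge (by positivity) ?_ ?_
            · exact (div_le_one hh0).mpr hh1
            · exact (div_le_one (by positivity)).mpr (one_le_pow₀ one_le_two)
        _ ≤ _ := by
            gcongr
            rw [hQ, add_assoc]
            exact le_add_of_nonneg_right (by positivity)
    calc _ ≤ (h : ℝ) := htriv
      _ ≤ C := hpn'.trans (le_max_right _ _)
      _ = C * h * (1 / h) := by field_simp
      _ ≤ _ := by gcongr
  rcases le_or_gt ((h : ℝ) ^ (n + 1)) p with hph | hph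
  · have hQ1 : 1 ≤ Q := by
      have : 1 ≤ (p : ℝ) / (h : ℝ) ^ (n + 1) := (one_le_div (by positivity)).mpr hph
      rw [hQ]
      exact this.trans (le_add_of_nonneg_left (by positivity))
    calc _ ≤ (h : ℝ) := htriv
      _ = 1 * h * 1 := by ring
      _ ≤ _ := by
          gcongr
          exact Real.one_le_rpow hQ1 (by positivity)
  have hS : ∑ u ∈ Finset.Icc 1 h, eInt p (F.eval (u : ℤ)) =
      ∑ u ∈ Ioc (0 : ℤ) h, eInt p (F.eval u) := by
    refine sum_bij' (fun u _ => (u : ℤ)) (fun u _ => u.toNat) ?_ ?_ ?_ ?_ ?_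
    · intro u hu
      rw [mem_Icc] at hu
      rw [mem_Ioc]
      omega
    · intro u hu
      rw [mem_Ioc] at hu
      rw [mem_Icc]
      omega
    · intro u _
      simp
    · intro u hu
      exact Int.toNat_of_nonneg (mem_Ioc.mp hu).1.le
    · intro u _
      rfl
  rw [hS]
  refine le_of_pow_le_pow_left₀ (n := 2 ^ n) (by positivity) (by positivity) ?_
  refine (hbound p hp hpn F hF hlead h hh hhp hph.le).trans ?_
  have hQpow : (Q ^ ((1 : ℝ) / 2 ^ n)) ^ 2 ^ n = Q := by
    have := Real.rpow_inv_natCast_pow (x := Q) (n := 2 ^ n) (by positivity) (by positivity)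
    rw [one_div]
    exact_mod_cast this
  have hhpow : ((h : ℝ) ^ (1 + ε)) ^ 2 ^ n =
      (h : ℝ) ^ 2 ^ n * ((h : ℝ) ^ (2 ^ n * ε / 2) * (h : ℝ) ^ (2 ^ n * ε / 2)) := by
    rw [← Real.rpow_add hh0, ← Real.rpow_natCast, ← Real.rpow_mul hh0.le,
      ← Real.rpow_natCast _ (2 ^ n), ← Real.rpow_add hh0]
    congr 1
    push_cast
    ring
  rw [mul_pow, mul_pow, hQpow, hhpow, ← mul_assoc (C ^ 2 ^ n)]
  have hMC : M ≤ C ^ 2 ^ n := (le_max_left _ _).trans (le_self_pow₀ hC1 (by positivity))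
  gcongr
  rw [hQ]
  gcongr
  exact le_add_of_nonneg_right (by positivity)
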